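/- arXiv:1607.00328 — 2 statements merged into one kernel-verified Lean document; each statement's English description precedes it below -/
import Mathlib

section
/- An infinite locally finite metric space X is properly amenable if and only if for every R > 0, ε > 0 and N ∈ ℕ there exists a finite non-empty set F ⊆ X with |∂_R F| ≤ ε·|F| and |F| ≥ N. -/
/-- A metric space is locally finite if every bounded set (closed ball) is finite. -/
def LocallyFiniteMS (X : Type*) [MetricSpace X] : Prop :=
  ∀ (x : X) (R : ℝ), {y : X | dist x y ≤ R}.Finite

/-- The `R`-boundary of a set `F`. -/
def rBoundary {X : Type*} [MetricSpace X] (R : ℝ) (F : Set X) : Set X :=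
  {x : X | (∃ y ∈ F, dist x y ≤ R) ∧ (∃ y ∉ F, dist x y ≤ R)}

/-- `F` is an `(R, ε)`-Følner set: finite, nonempty, with `|∂_R F| ≤ ε·|F|`. -/
def IsFolnerSet {X : Type*} [MetricSpace X] (R ε : ℝ) (F : Set X) : Prop :=
  F.Finite ∧ F.Nonempty ∧ ((rBoundary R F).ncard : ℝ) ≤ ε * F.ncard

/-- `X` is properly amenable. -/
def ProperlyAmenable (X : Type*) [MetricSpace X] : Prop :=
  ∀ R > (0:ℝ), ∀ ε > (0:ℝ), ∀ A : Set X, A.Finite →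
    ∃ F : Set X, IsFolnerSet R ε F ∧ A ⊆ F

/-- In a locally finite space, the `R`-neighbourhood of a finite set is finite. -/
theorem LocallyFiniteMS.finite_neighbourhood {X : Type*} [MetricSpace X]
    (hlf : LocallyFiniteMS X) (R : ℝ) {A : Set X} (hA : A.Finite) :
    {x : X | ∃ y ∈ A, dist x y ≤ R}.Finite := by
  refine (hA.biUnion fun y _ => hlf y R).subset ?_
  rintro x ⟨y, hy, hxy⟩
  simp only [Set.mem_iUnion, Set.mem_ofPred_eq]
  exact ⟨y, hy, dist_comm x y ▸ hxy⟩

theorem rBoundary_union_subset {X : Type*} [MetricSpace X] (R : ℝ) (F A : Set X) :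
    rBoundary R (F ∪ A) ⊆ rBoundary R F ∪ {x : X | ∃ y ∈ A, dist x y ≤ R} := by
  rintro x ⟨⟨y, hy | hy, hxy⟩, z, hz, hxz⟩
  · exact Or.inl ⟨⟨y, hy, hxy⟩, z, fun h => hz (Or.inl h), hxz⟩
  · exact Or.inr ⟨y, hy, hxy⟩

theorem stmt0 {X : Type*} [MetricSpace X] [Infinite X] (hlf : LocallyFiniteMS X) :
    ProperlyAmenable X ↔
      ∀ R > (0:ℝ), ∀ ε > (0:ℝ), ∀ N : ℕ,
        ∃ F : Set X, IsFolnerSet R ε F ∧ N ≤ F.ncard := by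
  constructor
  · intro h R hR ε hε N
    obtain ⟨A, hA⟩ := Infinite.exists_subset_card_eq X N
    obtain ⟨F, hF, hAF⟩ := h R hR ε hε A A.finite_toSet
    refine ⟨F, hF, ?_⟩
    rw [← hA, ← Set.ncard_coe_finset]
    exact Set.ncard_le_ncard hAF hF.1
  · intro h R hR ε hε A hA
    set B : Set X := {x : X | ∃ y ∈ A, dist x y ≤ R}
    have hB : B.Finite := hlf.finite_neighbourhood R hA
    obtain ⟨N, hN⟩ := exists_nat_ge ((B.ncard : ℝ) / (ε / 2))
    obtain ⟨F, ⟨hF, hne, hbd⟩, hNF⟩ := h R hR (ε / 2) (half_pos hε) N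
    refine ⟨F ∪ A, ⟨hF.union hA, hne.inl, ?_⟩, Set.subset_union_right⟩
    have hfin : (rBoundary R F).Finite :=
      (hlf.finite_neighbourhood R hF).subset fun x hx => hx.1
    have hcard : ((rBoundary R (F ∪ A)).ncard : ℝ) ≤ (rBoundary R F).ncard + B.ncard := by
      exact_mod_cast (Set.ncard_le_ncard (rBoundary_union_subset R F A) (hfin.union hB)).trans
        (Set.ncard_union_le _ _)
    have hBF : (B.ncard : ℝ) ≤ F.ncard * (ε / 2) :=
      (div_le_iff₀ (half_pos hε)).1 (hN.trans (by exact_mod_cast hNF))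
    have hmono : (F.ncard : ℝ) ≤ (F ∪ A).ncard := by
      exact_mod_cast Set.ncard_le_ncard Set.subset_union_left (hF.union hA)
    calc ((rBoundary R (F ∪ A)).ncard : ℝ) ≤ ε * F.ncard := by linarith
      _ ≤ ε * (F ∪ A).ncard := by gcongr
end

section
/- Fix λ > 1. A K-algebra A is not left algebraically amenable if and only if there exists a finite subset F ⊆ A such that for every nonzero finite-dimensional subspace W ⊆ A one has dim(span(F·W) + W) > λ·dim(W). -/
/-- `W` is a left `(F, ε)`-Følner subspace: a nonzero finite-dimensional subspace with
`dim(aW + W) ≤ (1+ε)·dim W` for all `a ∈ F`. -/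
def IsFolnerSubspace (K : Type*) {A : Type*} [Field K] [NonUnitalRing A] [Module K A]
    [SMulCommClass K A A] [IsScalarTower K A A]
    (F : Finset A) (ε : ℝ) (W : Submodule K A) : Prop :=
  W ≠ ⊥ ∧ FiniteDimensional K W ∧
    ∀ a ∈ F, (Module.finrank K ↥(W.map (LinearMap.mulLeft K a) ⊔ W) : ℝ) ≤
      (1 + ε) * (Module.finrank K ↥W : ℝ)

/-- Left algebraic amenability. -/
def AlgAmenable (K A : Type*) [Field K] [NonUnitalRing A] [Module K A]
    [SMulCommClass K A A] [IsScalarTower K A A] : Prop :=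
  ∀ ε > (0:ℝ), ∀ F : Finset A, ∃ W : Submodule K A, IsFolnerSubspace K F ε W

/-- Proper left algebraic amenability. -/
def ProperlyAlgAmenable (K A : Type*) [Field K] [NonUnitalRing A] [Module K A]
    [SMulCommClass K A A] [IsScalarTower K A A] : Prop :=
  ∀ ε > (0:ℝ), ∀ F : Finset A, ∃ W : Submodule K A,
    IsFolnerSubspace K F ε W ∧ ∀ a ∈ F, a ∈ W

section

variable {K A : Type*} [Field K] [NonUnitalRing A] [Module K A]
    [SMulCommClass K A A]

/-- The subspace `span(F·W) + W`. -/
def leftExpansion (F : Finset A) (W : Submodule K A) : Submodule K A :=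
  (F.sup fun a => W.map (LinearMap.mulLeft K a)) ⊔ W

theorem leftExpansion_empty (W : Submodule K A) : leftExpansion ∅ W = W := by
  rw [leftExpansion, Finset.sup_empty, bot_sup_eq]

theorem map_mulLeft_le_leftExpansion {F : Finset A} (W : Submodule K A) {a : A} (ha : a ∈ F) :
    W.map (LinearMap.mulLeft K a) ≤ leftExpansion F W :=
  (Finset.le_sup (f := fun a => W.map (LinearMap.mulLeft K a)) ha).trans le_sup_left

theorem finiteDimensional_leftExpansion (F : Finset A) (W : Submodule K A)
    [FiniteDimensional K W] : FiniteDimensional K (leftExpansion F W) := by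
  have : FiniteDimensional K ↥(F.sup fun a => W.map (LinearMap.mulLeft K a)) :=
    Submodule.finiteDimensional_finset_sup F _
  exact Submodule.finiteDimensional_sup _ _

theorem finrank_leftExpansion_le (F : Finset A) (W : Submodule K A) [FiniteDimensional K W]
    {δ : ℝ} (h : ∀ a ∈ F, (Module.finrank K ↥(W.map (LinearMap.mulLeft K a) ⊔ W) : ℝ) ≤
      Module.finrank K W + δ) :
    (Module.finrank K (leftExpansion F W) : ℝ) ≤ Module.finrank K W + F.card * δ := by
  classical
  induction F using Finset.induction_on with
  | empty => rw [leftExpansion_empty]; simp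
  | insert a F haF ih =>
    have ih := ih fun b hb => h b (Finset.mem_insert_of_mem hb)
    have ha := h a (Finset.mem_insert_self a F)
    have := finiteDimensional_leftExpansion F W
    have hsup : leftExpansion (insert a F) W =
        (W.map (LinearMap.mulLeft K a) ⊔ W) ⊔ leftExpansion F W := by
      simp only [leftExpansion, Finset.sup_insert]
      rw [sup_assoc, sup_assoc, sup_eq_right.mpr (le_sup_right :
        W ≤ (F.sup fun a => W.map (LinearMap.mulLeft K a)) ⊔ W)]
    have hadd := Submodule.finrank_sup_add_finrank_inf_eq
      (W.map (LinearMap.mulLeft K a) ⊔ W) (leftExpansion F W)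
    have : FiniteDimensional K
        ↥((W.map (LinearMap.mulLeft K a) ⊔ W) ⊓ leftExpansion F W) :=
      Submodule.finiteDimensional_inf_right _ _
    have hinf : Module.finrank K W ≤
        Module.finrank K ↥((W.map (LinearMap.mulLeft K a) ⊔ W) ⊓ leftExpansion F W) :=
      Submodule.finrank_mono (le_inf le_sup_right le_sup_right)
    rw [hsup, Finset.card_insert_of_notMem haF]
    have hadd' := congrArg (Nat.cast (R := ℝ)) hadd
    have hinf' : (Module.finrank K W : ℝ) ≤ _ := Nat.cast_le.mpr hinf
    push_cast at hadd' ⊢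
    linarith

open scoped Pointwise in
theorem map_mulLeft_leftExpansion_sup_le [DecidableEq A] {F : Finset A} (G : Finset A)
    (W : Submodule K A) {a : A} (ha : a ∈ F) :
    (leftExpansion G W).map (LinearMap.mulLeft K a) ⊔ leftExpansion G W ≤
      leftExpansion (F ∪ G ∪ F * G) W := by
  refine sup_le ?_ (sup_le_sup_right (Finset.sup_mono fun x hx => by simp [hx]) W)
  rw [Submodule.map_le_iff_le_comap]
  refine sup_le (Finset.sup_le fun g hg => ?_) ?_
  · rw [← Submodule.map_le_iff_le_comap, ← Submodule.map_comp, ← LinearMap.mulLeft_mul]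
    exact map_mulLeft_le_leftExpansion W
      (Finset.mem_union_right _ (Finset.mul_mem_mul ha hg))
  · rw [← Submodule.map_le_iff_le_comap]
    exact map_mulLeft_le_leftExpansion W (by simp [ha])

variable [IsScalarTower K A A] in
theorem exists_pow_mul_finrank_le_leftExpansion {F : Finset A} {ε : ℝ} (hε : 0 < ε)
    (hF : ∀ W : Submodule K A, ¬ IsFolnerSubspace K F ε W) (n : ℕ) :
    ∃ G : Finset A, ∀ W : Submodule K A, W ≠ ⊥ → FiniteDimensional K W →
      (1 + ε) ^ n * (Module.finrank K W : ℝ) ≤ Module.finrank K (leftExpansion G W) := by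
  classical
  open scoped Pointwise in
  induction n with
  | zero => exact ⟨∅, fun W _ _ => by rw [leftExpansion_empty, pow_zero, one_mul]⟩
  | succ n ih =>
    obtain ⟨G, hG⟩ := ih
    refine ⟨F ∪ G ∪ F * G, fun W hW hfin => ?_⟩
    have hne : leftExpansion G W ≠ ⊥ := ne_bot_of_le_ne_bot hW le_sup_right
    have hfinG := finiteDimensional_leftExpansion G W
    have hfinE := finiteDimensional_leftExpansion (F ∪ G ∪ F * G) W
    have hnot := hF (leftExpansion G W)
    simp only [IsFolnerSubspace, not_and] at hnot
    have hnot := hnot hne hfinG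
    push Not at hnot
    obtain ⟨a, ha, hlt⟩ := hnot
    have hle : (Module.finrank K ↥((leftExpansion G W).map (LinearMap.mulLeft K a) ⊔
        leftExpansion G W) : ℝ) ≤ Module.finrank K (leftExpansion (F ∪ G ∪ F * G) W) :=
      Nat.cast_le.mpr (Submodule.finrank_mono (map_mulLeft_leftExpansion_sup_le G W ha))
    calc (1 + ε) ^ (n + 1) * (Module.finrank K W : ℝ)
        = (1 + ε) * ((1 + ε) ^ n * Module.finrank K W) := by ring
      _ ≤ (1 + ε) * Module.finrank K (leftExpansion G W) :=
          mul_le_mul_of_nonneg_left (hG W hW hfin) (by linarith)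
      _ ≤ _ := hlt.le.trans hle

end

theorem stmt14 {K A : Type*} [Field K] [NonUnitalRing A] [Module K A]
    [SMulCommClass K A A] [IsScalarTower K A A]
    (lam : ℝ) (hlam : 1 < lam) :
    ¬ AlgAmenable K A ↔
      ∃ F : Finset A, ∀ W : Submodule K A, W ≠ ⊥ → FiniteDimensional K W →
        lam * (Module.finrank K ↥W : ℝ) <
          (Module.finrank K ↥((F.sup fun a => W.map (LinearMap.mulLeft K a)) ⊔ W) : ℝ) := by
  constructor
  · intro h
    simp only [AlgAmenable] at h
    push Not at h
    obtain ⟨ε, hε, F, hF⟩ := h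
    obtain ⟨n, hn⟩ := pow_unbounded_of_one_lt lam (by linarith : 1 < 1 + ε)
    obtain ⟨G, hG⟩ := exists_pow_mul_finrank_le_leftExpansion hε hF n
    refine ⟨G, fun W hW hfin => lt_of_lt_of_le ?_ (hG W hW hfin)⟩
    have hpos : 0 < Module.finrank K W :=
      Nat.pos_of_ne_zero fun h0 => hW (Submodule.finrank_eq_zero.mp h0)
    exact mul_lt_mul_of_pos_right hn (Nat.cast_pos.mpr hpos)
  · rintro ⟨F, hF⟩ hA
    have hcard : (0 : ℝ) < F.card + 1 := by positivity
    obtain ⟨W, hW, hfin, hle⟩ := hA ((lam - 1) / (F.card + 1))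
      (div_pos (by linarith) hcard) F
    have hlt := hF W hW hfin
    have hbound := finrank_leftExpansion_le F W
      (δ := (lam - 1) / (F.card + 1) * Module.finrank K W)
      fun a ha => (hle a ha).trans_eq (by ring)
    have hε : F.card * ((lam - 1) / (F.card + 1)) ≤ lam - 1 := by
      rw [← mul_div_assoc, div_le_iff₀ hcard]
      nlinarith
    have hmul := mul_le_mul_of_nonneg_right hε (Nat.cast_nonneg (α := ℝ) (Module.finrank K W))
    unfold leftExpansion at hbound
    linarith
end
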